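/- For every n ≥ 1 and m ≥ 0, the number of Schröder paths of semilength n with exactly n−m diagonal steps equals the number of rooted planar trees with n+1 leaves and m internal nodes in which every internal node has at least two children, plus the number of such trees with n+1 leaves and m+1 internal nodes: |SP(n,m)| = |PT(n,m)| + |PT(n,m+1)|. -/

import Mathlib

/-! Schröder paths -/

inductive SStep : Type
  | H | V | D
deriving DecidableEq

def SStep.dx : SStep → ℕ
  | .H => 1 | .V => 0 | .D => 1

def SStep.dy : SStep → ℕ
  | .H => 0 | .V => 1 | .D => 1

def pathX (p : List SStep) : ℕ := (p.map SStep.dx).sum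
def pathY (p : List SStep) : ℕ := (p.map SStep.dy).sum

/-- A Schröder path of semilength `n`: from (0,0) to (n,n), steps H,V,D,
never rising above the diagonal. -/
def IsSchroder (n : ℕ) (p : List SStep) : Prop :=
  pathX p = n ∧ pathY p = n ∧ ∀ q : List SStep, q <+: p → pathY q ≤ pathX q

/-- No diagonal step starts on the diagonal. -/
def DiagFree (p : List SStep) : Prop :=
  ∀ q r : List SStep, p = q ++ SStep.D :: r → pathX q ≠ pathY q

/-- Every diagonal step is immediately followed by a horizontal step,
except if it is the last step. -/
def DFollowedByH (p : List SStep) : Prop :=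
  ∀ q r : List SStep, p = q ++ SStep.D :: r → r = [] ∨ ∃ r' : List SStep, r = SStep.H :: r'

def SP (n m : ℕ) : Type := {p : List SStep // IsSchroder n p ∧ p.count SStep.D + m = n}
def SPplus (n m : ℕ) : Type :=
  {p : List SStep // IsSchroder n p ∧ p.count SStep.D + m = n ∧ DiagFree p}
def SPzero (n m : ℕ) : Type :=
  {p : List SStep // IsSchroder n p ∧ p.count SStep.D + m = n ∧ ¬ DiagFree p}
def RP (n m : ℕ) : Type :=
  {p : List SStep // IsSchroder n p ∧ p.count SStep.D + m = n ∧ DFollowedByH p}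

/-! Rooted planar trees -/

inductive PTree : Type
  | node : List PTree → PTree

namespace PTree

def leaves : PTree → ℕ
  | node [] => 1
  | node (c :: cs) => ((c :: cs).attach.map fun x => leaves x.1).sum
decreasing_by
  have := List.sizeOf_lt_of_mem x.2
  simp only [PTree.node.sizeOf_spec, List.cons.sizeOf_spec] at this ⊢
  omega

def internal : PTree → ℕ
  | node [] => 0
  | node (c :: cs) => 1 + ((c :: cs).attach.map fun x => internal x.1).sum
decreasing_by
  have := List.sizeOf_lt_of_mem x.2
  simp only [PTree.node.sizeOf_spec, List.cons.sizeOf_spec] at this ⊢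
  omega

def Good : PTree → Prop
  | node cs => cs.length ≠ 1 ∧ ∀ c ∈ cs.attach, Good c.1
decreasing_by
  have := List.sizeOf_lt_of_mem c.2
  simp only [PTree.node.sizeOf_spec] at this ⊢
  omega

end PTree

def PT (n m : ℕ) : Type :=
  {t : PTree // t.Good ∧ t.leaves = n + 1 ∧ t.internal = m}

def PTn (n : ℕ) : Type := {t : PTree // t.Good ∧ t.leaves = n + 1}

/-! Motzkin paths -/

inductive MStep : Type
  | U | H | D
deriving DecidableEq

def MStep.dh : MStep → ℤ
  | .U => 1 | .H => 0 | .D => -1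

def mHeight (p : List MStep) : ℤ := (p.map MStep.dh).sum

def IsMotzkin (k : ℕ) (p : List MStep) : Prop :=
  p.length = k ∧ mHeight p = 0 ∧ ∀ q : List MStep, q <+: p → 0 ≤ mHeight q

def HFollowedByU (p : List MStep) : Prop :=
  ∀ q r : List MStep, p = q ++ MStep.H :: r → r = [] ∨ ∃ r' : List MStep, r = MStep.U :: r'

def MP (k : ℕ) : Type := {p : List MStep // IsMotzkin k p}
def RMP (k : ℕ) : Type := {p : List MStep // IsMotzkin k p ∧ HFollowedByU p}

/-- Motzkin steps with two possible colors on up and horizontal steps. -/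
inductive CMStep : Type
  | U : Bool → CMStep
  | H : Bool → CMStep
  | D : CMStep
deriving DecidableEq

def CMStep.forget : CMStep → MStep
  | .U _ => .U | .H _ => .H | .D => .D

/-- (h,u)-colored Motzkin paths of length n-1. -/
def huMP (n : ℕ) : Type := {p : List CMStep // IsMotzkin (n - 1) (p.map CMStep.forget)}


namespace PTree

theorem leaves_node {cs : List PTree} (h : cs ≠ []) :
    (node cs).leaves = (cs.map leaves).sum := by
  cases cs with
  | nil => exact absurd rfl h
  | cons c cs => rw [leaves, List.attach_map_val]

theorem internal_node {cs : List PTree} (h : cs ≠ []) :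
    (node cs).internal = 1 + (cs.map internal).sum := by
  cases cs with
  | nil => exact absurd rfl h
  | cons c cs => rw [internal, List.attach_map_val]

@[simp] theorem leaves_leaf : (node []).leaves = 1 := by rw [leaves]

@[simp] theorem internal_leaf : (node []).internal = 0 := by rw [internal]

theorem good_node (cs : List PTree) :
    (node cs).Good ↔ cs.length ≠ 1 ∧ ∀ c ∈ cs, c.Good := by
  rw [Good]
  simp

@[simp] theorem good_leaf : (node []).Good := by simp [good_node]

end PTree

open PTree

/-- A nonempty planar forest in which every internal node has at least two children. -/
def GoodForest (L : List PTree) : Prop := L ≠ [] ∧ ∀ t ∈ L, t.Good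

def forestLeaves (L : List PTree) : ℕ := (L.map leaves).sum

def forestInternal (L : List PTree) : ℕ := (L.map internal).sum

/-- Good forests with `n + 1` leaves and `m` internal nodes. -/
def GF (n m : ℕ) : Type :=
  {L : List PTree // GoodForest L ∧ forestLeaves L = n + 1 ∧ forestInternal L = m}

/-! Forests and trees -/

/-- A tree is a one-tree forest; a tree with an internal root is turned into the forest of the
subtrees of its root. -/
def forestOfTree (n m : ℕ) : PT n m ⊕ PT n (m + 1) → GF n m
  | .inl ⟨t, ht⟩ => ⟨[t], by simpa [GoodForest, forestLeaves, forestInternal] using ht⟩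
  | .inr ⟨node cs, ht⟩ => ⟨cs, by
      obtain ⟨hg, hl, hi⟩ := ht
      have hcs : cs ≠ [] := by
        rintro rfl
        simp at hi
      rw [leaves_node hcs] at hl
      rw [internal_node hcs] at hi
      rw [good_node] at hg
      exact ⟨⟨hcs, hg.2⟩, hl, by unfold forestInternal; omega⟩⟩

theorem forestOfTree_bijective (n m : ℕ) : Function.Bijective (forestOfTree n m) := by
  constructor
  · rintro (⟨t, ht⟩ | ⟨⟨cs⟩, ht⟩) (⟨u, hu⟩ | ⟨⟨ds⟩, hu⟩) h <;>
      have h' := congrArg Subtype.val h <;> simp only [forestOfTree] at h'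
    · cases h'; rfl
    · subst h'; exact absurd rfl ((good_node _).1 hu.1).1
    · subst h'; exact absurd rfl ((good_node _).1 ht.1).1
    · subst h'; rfl
  · rintro ⟨L, ⟨hne, hg⟩, hl, hi⟩
    by_cases h1 : L.length = 1
    · obtain ⟨t, rfl⟩ := List.length_eq_one_iff.1 h1
      exact ⟨.inl ⟨t, by simpa using hg, by simpa [forestLeaves] using hl,
        by simpa [forestInternal] using hi⟩, rfl⟩
    · exact ⟨.inr ⟨node L, (good_node L).2 ⟨h1, hg⟩, (leaves_node hne).trans hl, by
        rw [internal_node hne, ← hi, forestInternal, add_comm]⟩, rfl⟩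

/-! Path suffixes -/

/-- A path that starts `h` units below the diagonal, ends on it and never rises above it. -/
def IsSuffixFrom (h : ℕ) (p : List SStep) : Prop :=
  pathY p = pathX p + h ∧ ∀ q : List SStep, q <+: p → pathY q ≤ pathX q + h

@[simp] theorem pathX_nil : pathX [] = 0 := rfl
@[simp] theorem pathY_nil : pathY [] = 0 := rfl
@[simp] theorem pathX_cons (a : SStep) (p : List SStep) : pathX (a :: p) = a.dx + pathX p := by
  simp [pathX]
@[simp] theorem pathY_cons (a : SStep) (p : List SStep) : pathY (a :: p) = a.dy + pathY p := by
  simp [pathY]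

theorem isSuffixFrom_nil (h : ℕ) : IsSuffixFrom h [] ↔ h = 0 := by
  simp [IsSuffixFrom, eq_comm]

theorem isSuffixFrom_cons (h : ℕ) (a : SStep) (p : List SStep) :
    IsSuffixFrom h (a :: p) ↔ ∃ k, k + a.dy = h + a.dx ∧ IsSuffixFrom k p := by
  simp only [IsSuffixFrom, pathX_cons, pathY_cons, List.prefix_cons_iff]
  constructor
  · rintro ⟨h1, h2⟩
    have h0 := h2 [a] (.inr ⟨[], rfl, by simp⟩)
    simp only [pathX_cons, pathY_cons, pathX_nil, pathY_nil] at h0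
    refine ⟨h + a.dx - a.dy, by omega, by omega, fun q hq => ?_⟩
    have h3 := h2 (a :: q) (.inr ⟨q, rfl, hq⟩)
    simp only [pathX_cons, pathY_cons] at h3
    omega
  · rintro ⟨k, hk, h1, h2⟩
    refine ⟨by omega, ?_⟩
    rintro q (rfl | ⟨r, rfl, hr⟩)
    · simp
    · have := h2 r hr
      simp only [pathX_cons, pathY_cons]
      omega

theorem isSchroder_iff (n : ℕ) (p : List SStep) :
    IsSchroder n p ↔ pathX p = n ∧ IsSuffixFrom 0 p := by
  simp only [IsSchroder, IsSuffixFrom, add_zero]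
  constructor
  · rintro ⟨rfl, h, h'⟩
    exact ⟨rfl, h, h'⟩
  · rintro ⟨rfl, h, h'⟩
    exact ⟨rfl, h, h'⟩

theorem pathX_eq_count (p : List SStep) : pathX p = p.count .H + p.count .D := by
  induction p with
  | nil => rfl
  | cons a p ih => cases a <;> simp [ih, SStep.dx] <;> omega

theorem pathY_eq_count (p : List SStep) : pathY p = p.count .V + p.count .D := by
  induction p with
  | nil => rfl
  | cons a p ih => cases a <;> simp [ih, SStep.dy] <;> omega

theorem length_eq_count (p : List SStep) :
    p.length = p.count .H + p.count .V + p.count .D := by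
  induction p with
  | nil => rfl
  | cons a p ih => cases a <;> simp [ih] <;> omega

/-! Parsing a path into a stack of forests -/

/-- The effect of prepending a step to a path on its stack of forests. -/
def pushStep : SStep → List (List PTree) → List (List PTree)
  | .V, s => [node []] :: s
  | .D, a :: s => (node [] :: a) :: s
  | .H, [t] :: b :: s => [node (t :: b)] :: s
  | .H, a :: b :: s => (node a :: b) :: s
  | _, s => s

def parse : List SStep → List (List PTree)
  | [] => [[node []]]
  | a :: p => pushStep a (parse p)

def stackLeaves (s : List (List PTree)) : ℕ := (s.map forestLeaves).sum

def stackInternal (s : List (List PTree)) : ℕ := (s.map forestInternal).sum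

theorem forest_shape {a : List PTree} (ha : a ≠ []) :
    (∃ t, a = [t]) ∨ ∃ t u c, a = t :: u :: c := by
  match a, ha with
  | [t], _ => exact .inl ⟨t, rfl⟩
  | t :: u :: c, _ => exact .inr ⟨t, u, c, rfl⟩

theorem parse_spec (p : List SStep) : ∀ h, IsSuffixFrom h p →
    (parse p).length = h + 1 ∧ (∀ L ∈ parse p, GoodForest L) ∧
      stackLeaves (parse p) = p.count .D + p.count .V + 1 ∧
      stackInternal (parse p) = p.count .H := by
  induction p with
  | nil =>
    intro h hp
    rw [isSuffixFrom_nil] at hp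
    simp [hp, parse, GoodForest, stackLeaves, stackInternal, forestLeaves, forestInternal]
  | cons x p ih =>
    intro h hp
    obtain ⟨k, hk, hp⟩ := (isSuffixFrom_cons ..).1 hp
    obtain ⟨h1, h2, h3, h4⟩ := ih k hp
    rw [parse]
    generalize parse p = s at *
    cases x with
    | V =>
      simp only [SStep.dx, SStep.dy] at hk
      refine ⟨by simp [pushStep]; omega, ?_, ?_, ?_⟩
      · simpa [pushStep, GoodForest] using h2
      · simp [pushStep, stackLeaves, forestLeaves] at h3 ⊢; omega
      · simp [pushStep, stackInternal, forestInternal] at h4 ⊢; omega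
    | D =>
      simp only [SStep.dx, SStep.dy] at hk
      obtain ⟨a, s, rfl⟩ := List.exists_cons_of_length_eq_add_one h1
      refine ⟨by simp [pushStep] at h1 ⊢; omega, ?_, ?_, ?_⟩
      · simp [pushStep, GoodForest] at h2 ⊢; tauto
      · simp [pushStep, stackLeaves, forestLeaves] at h3 ⊢; omega
      · simp [pushStep, stackInternal, forestInternal] at h4 ⊢; omega
    | H =>
      simp only [SStep.dx, SStep.dy] at hk
      obtain ⟨a, s, rfl⟩ := List.exists_cons_of_length_eq_add_one h1
      obtain ⟨b, s, rfl⟩ := List.exists_cons_of_length_eq_add_one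
        (show s.length = h + 1 by simp at h1; omega)
      have ha := h2 a (by simp)
      have hb := h2 b (by simp)
      obtain ⟨t, rfl⟩ | ⟨t, u, c, rfl⟩ := forest_shape ha.1
      · refine ⟨by simp [pushStep] at h1 ⊢; omega, ?_, ?_, ?_⟩
        · simp [pushStep, GoodForest, good_node] at h2 hb ⊢; tauto
        · simp [pushStep, stackLeaves, forestLeaves, leaves_node] at h3 ⊢; omega
        · simp [pushStep, stackInternal, forestInternal, internal_node] at h4 ⊢; omega
      · refine ⟨by simp [pushStep] at h1 ⊢; omega, ?_, ?_, ?_⟩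
        · simp [pushStep, GoodForest, good_node] at h2 hb ⊢; tauto
        · simp [pushStep, stackLeaves, forestLeaves, leaves_node] at h3 ⊢; omega
        · simp [pushStep, stackInternal, forestInternal, internal_node] at h4 ⊢; omega

/-- The step and the stack it was applied to can be read off the resulting stack. -/
theorem pushStep_injective {x y : SStep} {s r : List (List PTree)}
    (hs : ∀ L ∈ s, L ≠ []) (hr : ∀ L ∈ r, L ≠ []) (hs1 : 1 + x.dx ≤ s.length + x.dy)
    (hr1 : 1 + y.dx ≤ r.length + y.dy) (hs0 : s ≠ []) (hr0 : r ≠ [])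
    (h : pushStep x s = pushStep y r) : x = y ∧ s = r := by
  have shape : ∀ {z : SStep} {s : List (List PTree)}, (∀ L ∈ s, L ≠ []) →
      1 + z.dx ≤ s.length + z.dy → s ≠ [] →
      (z = .V ∧ pushStep z s = [node []] :: s) ∨
      (z = .D ∧ ∃ t a s', s = (t :: a) :: s' ∧ pushStep z s = (node [] :: t :: a) :: s') ∨
      (z = .H ∧ ∃ t u b s', s = [t] :: (u :: b) :: s' ∧
        pushStep z s = [node (t :: u :: b)] :: s') ∨
      (z = .H ∧ ∃ t v a u b s', s = (t :: v :: a) :: (u :: b) :: s' ∧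
        pushStep z s = (node (t :: v :: a) :: u :: b) :: s') := by
    intro z s hs h1 h0
    match z, s with
    | .V, s => exact .inl ⟨rfl, rfl⟩
    | _, [] :: s => exact absurd rfl (hs [] (by simp))
    | .D, (t :: a) :: s => exact .inr (.inl ⟨rfl, t, a, s, rfl, rfl⟩)
    | .H, [a] => simp [SStep.dx, SStep.dy] at h1
    | .H, a :: [] :: s => exact absurd rfl (hs [] (by simp))
    | .H, [t] :: (u :: b) :: s => exact .inr (.inr (.inl ⟨rfl, t, u, b, s, rfl, rfl⟩))
    | .H, (t :: v :: a) :: (u :: b) :: s =>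
      exact .inr (.inr (.inr ⟨rfl, t, v, a, u, b, s, rfl, rfl⟩))
  have h1 := shape hs hs1 hs0
  have h2 := shape hr hr1 hr0
  rw [h] at h1
  grind

theorem pushStep_ne_leaf (x : SStep) {s : List (List PTree)} (hs : ∀ L ∈ s, L ≠ [])
    (hs1 : 1 + x.dx ≤ s.length + x.dy) (hs0 : s ≠ []) : pushStep x s ≠ [[node []]] := by
  match x, s with
  | .V, s => simpa [pushStep] using hs0
  | _, [] :: s => exact absurd rfl (hs [] (by simp))
  | .D, (t :: a) :: s => simp [pushStep]
  | .H, [a] => simp [SStep.dx, SStep.dy] at hs1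
  | .H, [t] :: b :: s => simp [pushStep]
  | .H, (t :: v :: a) :: b :: s => simp [pushStep]

theorem parse_injective (p : List SStep) : ∀ (q : List SStep) (h k : ℕ), IsSuffixFrom h p →
    IsSuffixFrom k q → parse p = parse q → p = q := by
  have facts : ∀ {h : ℕ} {x : SStep} {p : List SStep}, IsSuffixFrom h (x :: p) →
      (∃ j, IsSuffixFrom j p) ∧ (∀ L ∈ parse p, L ≠ []) ∧
        1 + x.dx ≤ (parse p).length + x.dy ∧ parse p ≠ [] := by
    intro h x p hp
    obtain ⟨j, hj, hp⟩ := (isSuffixFrom_cons ..).1 hp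
    obtain ⟨h1, h2, -⟩ := parse_spec p j hp
    exact ⟨⟨j, hp⟩, fun L hL => (h2 L hL).1, by omega, List.ne_nil_of_length_eq_add_one h1⟩
  induction p with
  | nil =>
    rintro (_ | ⟨y, q⟩) h k hp hq hpq
    · rfl
    · obtain ⟨-, h1, h2, h3⟩ := facts hq
      exact absurd hpq.symm (pushStep_ne_leaf y h1 h2 h3)
  | cons x p ih =>
    rintro (_ | ⟨y, q⟩) h k hp hq hpq
    · obtain ⟨-, h1, h2, h3⟩ := facts hp
      exact absurd hpq (pushStep_ne_leaf x h1 h2 h3)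
    · obtain ⟨⟨i, hi⟩, h1, h2, h3⟩ := facts hp
      obtain ⟨⟨j, hj⟩, k1, k2, k3⟩ := facts hq
      obtain ⟨rfl, hs⟩ := pushStep_injective h1 k1 h2 k2 h3 k3 hpq
      rw [ih q i j hi hj hs]

theorem parse_surjective (N : ℕ) : ∀ (s : List (List PTree)) (h : ℕ), s.length = h + 1 →
    (∀ L ∈ s, GoodForest L) → stackLeaves s + stackInternal s = N →
    ∃ p, IsSuffixFrom h p ∧ parse p = s := by
  induction N using Nat.strong_induction_on with
  | _ N ih =>
    intro s h hlen hg hN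
    obtain ⟨a, s, rfl⟩ := List.exists_cons_of_length_eq_add_one hlen
    have ha := hg a (by simp)
    have hs : ∀ L ∈ s, GoodForest L := fun L hL => hg L (by simp [hL])
    simp only [List.length_cons, Nat.add_right_cancel_iff] at hlen
    have cons_spec : ∀ (x : SStep) (s' : List (List PTree)) (k : ℕ), k + x.dy = h + x.dx →
        s'.length = k + 1 → (∀ L ∈ s', GoodForest L) →
        stackLeaves s' + stackInternal s' < N → pushStep x s' = a :: s →
        ∃ p, IsSuffixFrom h p ∧ parse p = a :: s := by
      intro x s' k hk h1 h2 h3 h4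
      obtain ⟨p, hp, rfl⟩ := ih _ h3 s' k h1 h2 rfl
      exact ⟨x :: p, (isSuffixFrom_cons ..).2 ⟨k, hk, hp⟩, h4⟩
    obtain ⟨t, rfl⟩ | ⟨⟨d⟩, u, c, rfl⟩ := forest_shape ha.1
    · obtain ⟨cs⟩ := t
      match cs with
      | [] =>
        cases s with
        | nil => exact ⟨[], (isSuffixFrom_nil h).2 hlen.symm, rfl⟩
        | cons b s =>
          refine cons_spec .V (b :: s) s.length ?_ rfl hs ?_ rfl
          · simpa [SStep.dx, SStep.dy] using hlen
          · simp [stackLeaves, stackInternal, forestLeaves, forestInternal] at hN ⊢; omega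
      | [t] => exact absurd rfl ((good_node [t]).1 (ha.2 _ (by simp))).1
      | t :: b :: c =>
        have hc := ((good_node _).1 (ha.2 _ (List.mem_singleton_self _))).2
        refine cons_spec .H ([t] :: (b :: c) :: s) (h + 1) ?_ ?_ ?_ ?_ rfl
        · simp [SStep.dx, SStep.dy]
        · simp [hlen]
        · simp [GoodForest] at hc hs ⊢; tauto
        · simp [stackLeaves, stackInternal, forestLeaves, forestInternal, leaves_node,
            internal_node] at hN ⊢
          omega
    · match d with
      | [] =>
        refine cons_spec .D ((u :: c) :: s) h ?_ ?_ ?_ ?_ rfl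
        · simp [SStep.dx, SStep.dy]
        · simp [hlen]
        · simp [GoodForest] at ha hs ⊢; tauto
        · simp [stackLeaves, stackInternal, forestLeaves, forestInternal] at hN ⊢; omega
      | [t] => exact absurd rfl ((good_node [t]).1 (ha.2 _ (by simp))).1
      | t :: b :: d =>
        have hc := ((good_node _).1 (ha.2 _ List.mem_cons_self)).2
        refine cons_spec .H ((t :: b :: d) :: (u :: c) :: s) (h + 1) ?_ ?_ ?_ ?_ rfl
        · simp [SStep.dx, SStep.dy]
        · simp [hlen]
        · simp [GoodForest] at ha hc hs ⊢; tauto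
        · simp [stackLeaves, stackInternal, forestLeaves, forestInternal, leaves_node,
            internal_node] at hN ⊢
          omega

/-- The forest of a Schröder path. -/
def forestOfPath (n m : ℕ) (p : SP n m) : GF n m :=
  ⟨(parse p.1).headI, by
    obtain ⟨p, hp, hm⟩ := p
    obtain ⟨hX, hp⟩ := (isSchroder_iff ..).1 hp
    obtain ⟨h1, h2, h3, h4⟩ := parse_spec p 0 hp
    have hY := hp.1
    obtain ⟨L, hL⟩ := List.length_eq_one_iff.1 h1
    rw [pathX_eq_count] at hX hY
    rw [pathY_eq_count] at hY
    simp only [hL, List.headI_cons, stackLeaves, stackInternal, List.map_cons, List.map_nil,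
      List.sum_cons, List.sum_nil, List.mem_singleton, forall_eq] at h2 h3 h4 ⊢
    exact ⟨h2, by omega, by omega⟩⟩

theorem forestOfPath_bijective (n m : ℕ) : Function.Bijective (forestOfPath n m) := by
  constructor
  · rintro ⟨p, hp, hpm⟩ ⟨q, hq, hqm⟩ h
    have h' : (parse p).headI = (parse q).headI := congrArg Subtype.val h
    have hp' := ((isSchroder_iff ..).1 hp).2
    have hq' := ((isSchroder_iff ..).1 hq).2
    obtain ⟨L, hL⟩ := List.length_eq_one_iff.1 (parse_spec p 0 hp').1
    obtain ⟨K, hK⟩ := List.length_eq_one_iff.1 (parse_spec q 0 hq').1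
    exact Subtype.ext (parse_injective p q 0 0 hp' hq' (by simpa [hL, hK] using h'))
  · rintro ⟨L, hg, hl, hi⟩
    obtain ⟨p, hp, hpL⟩ := parse_surjective _ [L] 0 rfl (by simpa using hg) rfl
    obtain ⟨-, -, h3, h4⟩ := parse_spec p 0 hp
    have hY := hp.1
    have hX := pathX_eq_count p
    rw [pathY_eq_count] at hY
    simp only [hpL, stackLeaves, stackInternal, List.map_cons, List.map_nil, List.sum_cons,
      List.sum_nil] at h3 h4
    exact ⟨⟨p, (isSchroder_iff ..).2 ⟨by omega, hp⟩, by omega⟩,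
      Subtype.ext (by simp [forestOfPath, hpL])⟩

instance : Finite SStep :=
  Finite.of_injective (β := Fin 3) (fun | .H => 0 | .V => 1 | .D => 2) (by
    rintro ⟨⟩ ⟨⟩ <;> simp)

instance finite_SP (n m : ℕ) : Finite (SP n m) := by
  refine Set.Finite.subset (List.finite_length_le SStep (2 * n)) ?_
  rintro p ⟨⟨hX, hY, -⟩, -⟩
  rw [pathX_eq_count] at hX
  rw [pathY_eq_count] at hY
  simp only [Set.mem_ofPred_eq, length_eq_count]
  omega

/-- |SP(n,m)| = |PT(n,m)| + |PT(n,m+1)|. -/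
theorem statement2 (n m : ℕ) (hn : 1 ≤ n) :
    Nat.card (SP n m) = Nat.card (PT n m) + Nat.card (PT n (m + 1)) := by
  let e := (Equiv.ofBijective _ (forestOfPath_bijective n m)).trans
    (Equiv.ofBijective _ (forestOfTree_bijective n m)).symm
  have : Finite (PT n m ⊕ PT n (m + 1)) := Finite.of_equiv _ e
  have : Finite (PT n m) := Finite.sum_left (PT n (m + 1))
  have : Finite (PT n (m + 1)) := Finite.sum_right (PT n m)
  rw [Nat.card_congr e, Nat.card_sum]
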